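/- Let W be a real Weyl field on 4-dimensional Minkowski space, let T be a symmetric trace-free real two-index tensor (T_{ab} = T_{ba}, η^{ab} T_{ab} = 0), and set R_{abcd} = W_{abcd} + (1/2)(T_{ac} η_{bd} + T_{bd} η_{ac} - T_{ad} η_{bc} - T_{bc} η_{ad}). Then 𝓘_{abef} R^{efgh} 𝓘_{ghcd} = (1/2)(W_{abcd} + i ({}^*W)_{abcd}), where ({}^*W)_{abcd} = (1/2) ε_{abef} W^{ef}{}_{cd} is the left dual of W. -/

import Mathlib

noncomputable section

/-- Minkowski metric `η = diag(-1,1,1,1)`. -/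
def mk (a b : Fin 4) : ℝ := if a = b then (if a = 0 then -1 else 1) else 0

/-- Levi-Civita symbol, totally antisymmetric with `ε₀₁₂₃ = 1`
(Vandermonde product of the index values, normalized). -/
def lc (a b c d : Fin 4) : ℝ :=
  ((((b : ℕ) : ℝ) - ((a : ℕ) : ℝ)) * (((c : ℕ) : ℝ) - ((a : ℕ) : ℝ)) *
      (((d : ℕ) : ℝ) - ((a : ℕ) : ℝ)) * (((c : ℕ) : ℝ) - ((b : ℕ) : ℝ)) *
      (((d : ℕ) : ℝ) - ((b : ℕ) : ℝ)) * (((d : ℕ) : ℝ) - ((c : ℕ) : ℝ))) / 12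

/-- Complexified Minkowski metric. -/
def mkC (a b : Fin 4) : ℂ := (mk a b : ℝ)

/-- Complexified Levi-Civita symbol. -/
def lcC (a b c d : Fin 4) : ℂ := (lc a b c d : ℝ)

/-- Hodge dual of a real two-form: `(*X)_{ab} = (1/2) ε_{abcd} X^{cd}`. -/
def dualR (X : Fin 4 → Fin 4 → ℝ) (a b : Fin 4) : ℝ :=
  (1/2) * ∑ c, ∑ d, ∑ e, ∑ f, lc a b c d * mk c e * mk d f * X e f

/-- Hodge dual of a complex two-form. -/
def dualC (X : Fin 4 → Fin 4 → ℂ) (a b : Fin 4) : ℂ :=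
  (1/2) * ∑ c, ∑ d, ∑ e, ∑ f, lcC a b c d * mkC c e * mkC d f * X e f

/-- Anti-self-dual part `𝒳_{ab} = (1/2)(X_{ab} + i (*X)_{ab})` of a real two-form. -/
def asd (X : Fin 4 → Fin 4 → ℝ) (a b : Fin 4) : ℂ :=
  (1/2) * ((X a b : ℂ) + Complex.I * (dualR X a b : ℂ))

/-- `𝓘_{abcd} = (1/4)(η_{ac}η_{bd} - η_{ad}η_{bc} + i ε_{abcd})`. -/
def Iproj (a b c d : Fin 4) : ℂ :=
  (1/4) * (mkC a c * mkC b d - mkC a d * mkC b c + Complex.I * lcC a b c d)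

/-- A real Weyl field: all algebraic symmetries of the Weyl conformal tensor. -/
def IsWeylR (K : Fin 4 → Fin 4 → Fin 4 → Fin 4 → ℝ) : Prop :=
  (∀ a b c d, K a b c d = - K b a c d) ∧ (∀ a b c d, K a b c d = - K a b d c) ∧
  (∀ a b c d, K a b c d = K c d a b) ∧
  (∀ a b c d, K a b c d + K b c a d + K c a b d = 0) ∧
  (∀ b d, (∑ a, ∑ c, mk a c * K a b c d) = 0)

/-- Left dual `({}^*K)_{abcd} = (1/2) ε_{abef} K^{ef}{}_{cd}` of a real four-tensor. -/
def leftDualR (K : Fin 4 → Fin 4 → Fin 4 → Fin 4 → ℝ) (a b c d : Fin 4) : ℝ :=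
  (1/2) * ∑ e, ∑ f, ∑ g, ∑ h, lc a b e f * mk e g * mk f h * K g h c d

/-- Right dual `(K^*)_{abcd} = (1/2) K_{ab}{}^{ef} ε_{efcd}` of a real four-tensor. -/
def rightDualR (K : Fin 4 → Fin 4 → Fin 4 → Fin 4 → ℝ) (a b c d : Fin 4) : ℝ :=
  (1/2) * ∑ e, ∑ f, ∑ g, ∑ h, K a b e f * mk e g * mk f h * lc g h c d

/-- Raising all four indices with the Minkowski metric. -/
def raise4 (K : Fin 4 → Fin 4 → Fin 4 → Fin 4 → ℝ) (a b c d : Fin 4) : ℝ :=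
  ∑ e, ∑ f, ∑ g, ∑ h, mk a e * mk b f * mk c g * mk d h * K e f g h

/-- The diagonal entries of the Minkowski metric. -/
def mkSign (a : Fin 4) : ℝ := if a = 0 then -1 else 1

theorem mk_eq_ite (a b : Fin 4) : mk a b = if a = b then mkSign a else 0 := rfl

theorem lc_pair_comm (a b c d : Fin 4) : lc a b c d = lc c d a b := by
  unfold lc; ring

theorem mk_comm (a b : Fin 4) : mk a b = mk b a := by
  unfold mk; grind

theorem Iproj_pair_comm (a b c d : Fin 4) : Iproj a b c d = Iproj c d a b := by
  simp only [Iproj, mkC, lcC, lc_pair_comm a b c d, mk_comm a c, mk_comm b d, mk_comm a d,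
    mk_comm b c]
  ring

theorem raise4_eq (K : Fin 4 → Fin 4 → Fin 4 → Fin 4 → ℝ) (a b c d : Fin 4) :
    raise4 K a b c d = mkSign a * mkSign b * mkSign c * mkSign d * K a b c d := by
  simp [raise4, mk_eq_ite]

theorem dualR_eq (X : Fin 4 → Fin 4 → ℝ) (a b : Fin 4) :
    dualR X a b = (1/2) * ∑ c, ∑ d, lc a b c d * mkSign c * mkSign d * X c d := by
  simp [dualR, mk_eq_ite]

theorem dualC_eq (X : Fin 4 → Fin 4 → ℂ) (a b : Fin 4) :
    dualC X a b = (1/2) * ∑ c, ∑ d, lcC a b c d * mkSign c * mkSign d * X c d := by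
  simp [dualC, mkC, mk_eq_ite, apply_ite (Complex.ofReal)]

theorem leftDualR_eq_dualR (K : Fin 4 → Fin 4 → Fin 4 → Fin 4 → ℝ) (a b c d : Fin 4) :
    leftDualR K a b c d = dualR (fun e f => K e f c d) a b := rfl

theorem rightDualR_eq_dualR (K : Fin 4 → Fin 4 → Fin 4 → Fin 4 → ℝ) (a b c d : Fin 4) :
    rightDualR K a b c d = dualR (fun e f => K a b e f) c d := by
  simp only [dualR_eq, rightDualR, mk_eq_ite]
  simp [lc_pair_comm _ _ c d]
  refine Finset.sum_congr rfl fun e _ => Finset.sum_congr rfl fun f _ => ?_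
  ring

theorem dualR_add (X Y : Fin 4 → Fin 4 → ℝ) (a b : Fin 4) :
    dualR (fun c d => X c d + Y c d) a b = dualR X a b + dualR Y a b := by
  simp only [dualR_eq, mul_add, Finset.sum_add_distrib]

theorem dualR_sub (X Y : Fin 4 → Fin 4 → ℝ) (a b : Fin 4) :
    dualR (fun c d => X c d - Y c d) a b = dualR X a b - dualR Y a b := by
  simp only [dualR_eq, mul_sub, Finset.sum_sub_distrib]

theorem dualR_antisymm (X : Fin 4 → Fin 4 → ℝ) (a b : Fin 4) : dualR X a b = - dualR X b a := by
  have h (c d) : lc a b c d = - lc b a c d := by unfold lc; ring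
  simp [dualR_eq, h]

/-- The components of the Hodge dual of a two-form. -/
theorem dualR_components (X : Fin 4 → Fin 4 → ℝ) (hX : ∀ a b, X a b = - X b a) :
    dualR X 0 1 = X 2 3 ∧ dualR X 0 2 = - X 1 3 ∧ dualR X 0 3 = X 1 2 ∧
      dualR X 1 2 = - X 0 3 ∧ dualR X 1 3 = X 0 2 ∧ dualR X 2 3 = - X 0 1 := by
  refine ⟨?_, ?_, ?_, ?_, ?_, ?_⟩ <;>
    simp [dualR_eq, Fin.sum_univ_four, lc, mkSign] <;>
    linarith [hX 0 1, hX 0 2, hX 0 3, hX 1 2, hX 1 3, hX 2 3]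

/-- Two-forms are determined by their six independent components. -/
theorem twoForm_ext {X Y : Fin 4 → Fin 4 → ℝ} (hX : ∀ a b, X a b = - X b a)
    (hY : ∀ a b, Y a b = - Y b a)
    (h : X 0 1 = Y 0 1 ∧ X 0 2 = Y 0 2 ∧ X 0 3 = Y 0 3 ∧ X 1 2 = Y 1 2 ∧ X 1 3 = Y 1 3 ∧
      X 2 3 = Y 2 3) (a b : Fin 4) : X a b = Y a b := by
  obtain ⟨h01, h02, h03, h12, h13, h23⟩ := h
  fin_cases a <;> fin_cases b <;> dsimp only [Fin.reduceFinMk, Fin.zero_eta, Fin.mk_one] <;>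
    first
    | assumption
    | linarith [hX 0 0, hY 0 0, hX 1 1, hY 1 1, hX 2 2, hY 2 2, hX 3 3, hY 3 3]
    | (rw [hX, hY, neg_inj]; assumption)

/-- On two-forms in Lorentzian signature the Hodge dual squares to `-1`. -/
theorem dualR_dualR (X : Fin 4 → Fin 4 → ℝ) (hX : ∀ a b, X a b = - X b a) (a b : Fin 4) :
    dualR (dualR X) a b = - X a b := by
  refine twoForm_ext (X := dualR (dualR X)) (Y := fun a b => - X a b) (dualR_antisymm _)
    (fun a b => by rw [hX]) ?_ a b
  obtain ⟨h01, h02, h03, h12, h13, h23⟩ := dualR_components X hX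
  obtain ⟨k01, k02, k03, k12, k13, k23⟩ := dualR_components _ (dualR_antisymm X)
  simp only [k01, k02, k03, k12, k13, k23, h01, h02, h03, h12, h13, h23, and_self]

/-- Contraction with `𝓘` is the anti-self-dual projection. -/
theorem sum_Iproj_mul (X : Fin 4 → Fin 4 → ℂ) (hX : ∀ a b, X a b = - X b a) (a b : Fin 4) :
    ∑ e, ∑ f, Iproj a b e f * (mkSign e * mkSign f * X e f)
      = (1/2) * (X a b + Complex.I * dualC X a b) := by
  have hs (i) : ((mkSign i : ℝ) : ℂ) * mkSign i = 1 := by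
    unfold mkSign; split_ifs <;> simp
  have h₁ : ∑ e, ∑ f, mkC a e * mkC b f * (mkSign e * mkSign f * X e f) = X a b := by
    simp [mkC, mk_eq_ite, apply_ite (Complex.ofReal)]
    linear_combination (mkSign b * mkSign b * X a b) * hs a + X a b * hs b
  have h₂ : ∑ e, ∑ f, mkC a f * mkC b e * (mkSign e * mkSign f * X e f) = X b a := by
    simp [mkC, mk_eq_ite, apply_ite (Complex.ofReal)]
    linear_combination (mkSign b * mkSign b * X b a) * hs a + X b a * hs b
  have h₃ : ∑ e, ∑ f, Iproj a b e f * (mkSign e * mkSign f * X e f)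
      = (1/4) * (∑ e, ∑ f, mkC a e * mkC b f * (mkSign e * mkSign f * X e f)
        - ∑ e, ∑ f, mkC a f * mkC b e * (mkSign e * mkSign f * X e f)
        + Complex.I * ∑ e, ∑ f, lcC a b e f * mkSign e * mkSign f * X e f) := by
    simp only [Finset.mul_sum, ← Finset.sum_sub_distrib, ← Finset.sum_add_distrib]
    refine Finset.sum_congr rfl fun e _ => Finset.sum_congr rfl fun f _ => ?_
    simp only [Iproj]
    ring
  rw [h₃, h₁, h₂, dualC_eq, hX b a]
  ring

theorem dualC_ofReal_add_I_mul (X Y : Fin 4 → Fin 4 → ℝ) (a b : Fin 4) :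
    dualC (fun c d => (1/2) * ((X c d : ℂ) + Complex.I * Y c d)) a b
      = (1/2) * ((dualR X a b : ℂ) + Complex.I * dualR Y a b) := by
  simp only [dualC_eq, dualR_eq, lcC]
  push_cast
  simp only [Finset.mul_sum, ← Finset.sum_add_distrib]
  refine Finset.sum_congr rfl fun e _ => Finset.sum_congr rfl fun f _ => ?_
  ring

theorem dualC_ofReal (X : Fin 4 → Fin 4 → ℝ) (a b : Fin 4) :
    dualC (fun c d => (X c d : ℂ)) a b = dualR X a b := by
  simp [dualC, dualR, mkC, lcC]

/-- Two-sided contraction with `𝓘`, expanded in the left and right duals. -/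
theorem sum_Iproj_raise4_Iproj (K : Fin 4 → Fin 4 → Fin 4 → Fin 4 → ℝ)
    (h₁ : ∀ a b c d, K a b c d = - K b a c d) (h₂ : ∀ a b c d, K a b c d = - K a b d c)
    (a b c d : Fin 4) :
    ∑ e, ∑ f, ∑ g, ∑ h, Iproj a b e f * (raise4 K e f g h : ℂ) * Iproj g h c d
      = (1/4) * ((K a b c d : ℂ) + Complex.I * leftDualR K a b c d
        + Complex.I * rightDualR K a b c d - leftDualR (rightDualR K) a b c d) := by
  have inner (e f) : ∑ g, ∑ h, Iproj c d g h * (mkSign g * mkSign h * (K e f g h : ℂ))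
      = (1/2) * ((K e f c d : ℂ) + Complex.I * rightDualR K e f c d) := by
    rw [sum_Iproj_mul (fun g h => (K e f g h : ℂ)) fun g h => by simp [h₂ e f g h],
      dualC_ofReal, rightDualR_eq_dualR]
  have anti (e f) : rightDualR K e f c d = - rightDualR K f e c d := by
    simp [rightDualR, h₁ e f]
  calc _ = ∑ e, ∑ f, Iproj a b e f * (mkSign e * mkSign f *
        ∑ g, ∑ h, Iproj c d g h * (mkSign g * mkSign h * (K e f g h : ℂ))) := by
        simp only [Finset.mul_sum, raise4_eq]
        refine Finset.sum_congr rfl fun e _ => Finset.sum_congr rfl fun f _ =>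
          Finset.sum_congr rfl fun g _ => Finset.sum_congr rfl fun h _ => ?_
        rw [Iproj_pair_comm g h c d]
        push_cast
        ring
    _ = _ := by
        simp only [inner]
        rw [sum_Iproj_mul (fun e f => (1/2) * ((K e f c d : ℂ) + Complex.I * rightDualR K e f c d))
          fun e f => by rw [h₁ e f, anti e f]; push_cast; ring]
        rw [dualC_ofReal_add_I_mul, leftDualR_eq_dualR, leftDualR_eq_dualR]
        linear_combination (1/4) * (dualR (fun e f => rightDualR K e f c d) a b : ℂ) * Complex.I_sq

/-- To compare the right dual of a pairwise antisymmetric tensor with a multiple of its left dual,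
it suffices to look at independent components. -/
theorem rightDualR_eq_mul_leftDualR {K : Fin 4 → Fin 4 → Fin 4 → Fin 4 → ℝ} {s : ℝ}
    (h₁ : ∀ a b c d, K a b c d = - K b a c d) (h₂ : ∀ a b c d, K a b c d = - K a b d c)
    (h : ∀ p ∈ [((0 : Fin 4), (1 : Fin 4)), (0, 2), (0, 3), (1, 2), (1, 3), (2, 3)],
      K p.1 p.2 2 3 = s * dualR (fun e f => K e f 0 1) p.1 p.2 ∧
      - K p.1 p.2 1 3 = s * dualR (fun e f => K e f 0 2) p.1 p.2 ∧
      K p.1 p.2 1 2 = s * dualR (fun e f => K e f 0 3) p.1 p.2 ∧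
      - K p.1 p.2 0 3 = s * dualR (fun e f => K e f 1 2) p.1 p.2 ∧
      K p.1 p.2 0 2 = s * dualR (fun e f => K e f 1 3) p.1 p.2 ∧
      - K p.1 p.2 0 1 = s * dualR (fun e f => K e f 2 3) p.1 p.2)
    (a b c d : Fin 4) : rightDualR K a b c d = s * leftDualR K a b c d := by
  have hl (a b c d) : leftDualR K a b c d = - leftDualR K a b d c := by
    simp [leftDualR, h₂ _ _ c d]
  have hr (a b c d) : rightDualR K a b c d = - rightDualR K b a c d := by
    simp [rightDualR, h₁ a b]
  refine twoForm_ext (X := fun c d => rightDualR K a b c d)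
    (Y := fun c d => s * leftDualR K a b c d)
    (fun c d => by simp only [rightDualR_eq_dualR]; exact dualR_antisymm _ c d)
    (fun c d => by rw [hl]; ring) ?_ c d
  have key (c d) (hcd : ∀ p ∈ [((0 : Fin 4), (1 : Fin 4)), (0, 2), (0, 3), (1, 2), (1, 3), (2, 3)],
      rightDualR K p.1 p.2 c d = s * leftDualR K p.1 p.2 c d) :
      rightDualR K a b c d = s * leftDualR K a b c d := by
    refine twoForm_ext (X := fun a b => rightDualR K a b c d)
      (Y := fun a b => s * leftDualR K a b c d) (fun a b => hr a b c d)
      (fun a b => by simp only [leftDualR_eq_dualR]; rw [dualR_antisymm]; ring) ?_ a b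
    simpa using hcd
  have comp (p : Fin 4 × Fin 4) := dualR_components (fun e f => K p.1 p.2 e f) (h₂ p.1 p.2)
  simp only [rightDualR_eq_dualR, leftDualR_eq_dualR] at key ⊢
  exact ⟨key 0 1 fun p hp => (comp p).1.trans (h p hp).1,
    key 0 2 fun p hp => (comp p).2.1.trans (h p hp).2.1,
    key 0 3 fun p hp => (comp p).2.2.1.trans (h p hp).2.2.1,
    key 1 2 fun p hp => (comp p).2.2.2.1.trans (h p hp).2.2.2.1,
    key 1 3 fun p hp => (comp p).2.2.2.2.1.trans (h p hp).2.2.2.2.1,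
    key 2 3 fun p hp => (comp p).2.2.2.2.2.trans (h p hp).2.2.2.2.2⟩

/-- The left and right duals of a Weyl field agree. -/
theorem IsWeylR.rightDualR_eq_leftDualR {W : Fin 4 → Fin 4 → Fin 4 → Fin 4 → ℝ} (hW : IsWeylR W)
    (a b c d : Fin 4) : rightDualR W a b c d = leftDualR W a b c d := by
  obtain ⟨h₁, h₂, h₃, -, h₅⟩ := hW
  rw [← one_mul (leftDualR W a b c d)]
  refine rightDualR_eq_mul_leftDualR h₁ h₂ ?_ a b c d
  have z₁ (i c d) : W i i c d = 0 := by linarith [h₁ i i c d]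
  have z₂ (i a b) : W a b i i = 0 := by linarith [h₂ a b i i]
  have comp (c d) := dualR_components (fun e f => W e f c d) fun e f => h₁ e f c d
  have tr (b d) : - W 0 b 0 d + W 1 b 1 d + W 2 b 2 d + W 3 b 3 d = 0 := by
    simpa [mk_eq_ite, Fin.sum_univ_four, mkSign] using h₅ b d
  have t00 := tr 0 0
  have t01 := tr 0 1
  have t02 := tr 0 2
  have t03 := tr 0 3
  have t11 := tr 1 1
  have t12 := tr 1 2
  have t13 := tr 1 3
  have t22 := tr 2 2
  have t23 := tr 2 3
  have t33 := tr 3 3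
  simp only [z₁, z₂, h₁ 1 0, h₁ 2 0, h₁ 3 0, h₁ 2 1, h₁ 3 1, h₁ 3 2, h₂ _ _ 1 0, h₂ _ _ 2 0,
    h₂ _ _ 3 0, h₂ _ _ 2 1, h₂ _ _ 3 1, h₂ _ _ 3 2] at t00 t01 t02 t03 t11 t12 t13 t22 t23 t33
  simp only [List.forall_mem_cons, comp, one_mul, List.not_mem_nil, IsEmpty.forall_iff,
    implies_true, and_true]
  constructorm* _ ∧ _ <;>
    linarith [h₃ 0 1 0 2, h₃ 0 1 0 3, h₃ 0 1 1 2, h₃ 0 1 1 3, h₃ 0 1 2 3, h₃ 0 2 0 3, h₃ 0 2 1 2,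
      h₃ 0 2 1 3, h₃ 0 2 2 3, h₃ 0 3 1 2, h₃ 0 3 1 3, h₃ 0 3 2 3, h₃ 1 2 1 3, h₃ 1 2 2 3,
      h₃ 1 3 2 3]

/-- The product `(1/2) (T_{ac} η_{bd} + T_{bd} η_{ac} - T_{ad} η_{bc} - T_{bc} η_{ad})` of a
two-tensor with the metric. -/
def ricciPart (T : Fin 4 → Fin 4 → ℝ) (a b c d : Fin 4) : ℝ :=
  (1/2) * (T a c * mk b d + T b d * mk a c - T a d * mk b c - T b c * mk a d)

theorem ricciPart_antisymm_left (T : Fin 4 → Fin 4 → ℝ) (a b c d : Fin 4) :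
    ricciPart T a b c d = - ricciPart T b a c d := by
  unfold ricciPart; ring

theorem ricciPart_antisymm_right (T : Fin 4 → Fin 4 → ℝ) (a b c d : Fin 4) :
    ricciPart T a b c d = - ricciPart T a b d c := by
  unfold ricciPart; ring

/-- For trace-free symmetric `T` the left and right duals of `ricciPart T` are opposite. -/
theorem rightDualR_ricciPart (T : Fin 4 → Fin 4 → ℝ) (hTsymm : ∀ a b, T a b = T b a)
    (hTtr : (∑ a, ∑ b, mk a b * T a b) = 0) (a b c d : Fin 4) :
    rightDualR (ricciPart T) a b c d = - leftDualR (ricciPart T) a b c d := by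
  rw [← neg_one_mul]
  refine rightDualR_eq_mul_leftDualR (ricciPart_antisymm_left T) (ricciPart_antisymm_right T) ?_
    a b c d
  have comp (c d) := dualR_components (fun e f => ricciPart T e f c d)
    fun e f => ricciPart_antisymm_left T e f c d
  simp [mk_eq_ite, Fin.sum_univ_four, mkSign] at hTtr
  simp only [List.forall_mem_cons, comp, List.not_mem_nil, IsEmpty.forall_iff,
    implies_true, and_true]
  constructorm* _ ∧ _ <;> simp [ricciPart, mk] <;>
    linarith [hTsymm 0 1, hTsymm 0 2, hTsymm 0 3, hTsymm 1 2, hTsymm 1 3, hTsymm 2 3]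

/-- for `R_{abcd} = W_{abcd} + (1/2)(T_{ac}η_{bd} + T_{bd}η_{ac}
- T_{ad}η_{bc} - T_{bc}η_{ad})`, one has `𝓘_{abef} R^{efgh} 𝓘_{ghcd}
= (1/2)(W_{abcd} + i ({}^*W)_{abcd})`. -/
theorem weyl_projection_identity (W : Fin 4 → Fin 4 → Fin 4 → Fin 4 → ℝ)
    (hW : IsWeylR W) (T : Fin 4 → Fin 4 → ℝ)
    (hTsymm : ∀ a b, T a b = T b a) (hTtr : (∑ a, ∑ b, mk a b * T a b) = 0) :
    ∀ a b c d,
      (∑ e, ∑ f, ∑ g, ∑ h,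
          Iproj a b e f *
            (raise4 (fun a' b' c' d' =>
              W a' b' c' d' + (1/2) * (T a' c' * mk b' d' + T b' d' * mk a' c'
                - T a' d' * mk b' c' - T b' c' * mk a' d')) e f g h : ℂ) *
            Iproj g h c d)
        = (1/2) * ((W a b c d : ℂ) + Complex.I * (leftDualR W a b c d : ℂ)) := by
  intro a b c d
  have w₁ := hW.1
  have w₂ := hW.2.1
  have e₁ := ricciPart_antisymm_left T
  have e₂ := ricciPart_antisymm_right T
  have left : leftDualR (fun a b c d => W a b c d + ricciPart T a b c d) a b c d
      = leftDualR W a b c d + leftDualR (ricciPart T) a b c d := by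
    simp only [leftDualR_eq_dualR, dualR_add]
  have right (a b c d) : rightDualR (fun a b c d => W a b c d + ricciPart T a b c d) a b c d
      = leftDualR W a b c d - leftDualR (ricciPart T) a b c d := by
    rw [← hW.rightDualR_eq_leftDualR, sub_eq_add_neg, ← rightDualR_ricciPart T hTsymm hTtr]
    simp only [rightDualR_eq_dualR, dualR_add]
  have both : leftDualR (rightDualR fun a b c d => W a b c d + ricciPart T a b c d) a b c d
      = - W a b c d + ricciPart T a b c d := by
    rw [leftDualR_eq_dualR]
    simp only [right, leftDualR_eq_dualR, ← dualR_sub]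
    rw [dualR_dualR _ fun e f => by rw [w₁ e f, e₁ e f]; ring]
    ring
  refine (sum_Iproj_raise4_Iproj (fun a b c d => W a b c d + ricciPart T a b c d)
    (fun a b c d => by rw [w₁ a b, e₁ a b]; ring)
    (fun a b c d => by rw [w₂ a b c d, e₂ a b c d]; ring) a b c d).trans ?_
  rw [left, right, both]
  push_cast
  ring
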